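/- Let Λ = {A,B}, let G_A be the graph with a single node and a single A-labeled loop, and let G_B be the graph with a single node and a single B-labeled loop. Then there exists no Λ-labeled type graph T such that L(T) = L(G_A) ∪ L(G_B); i.e., type graph languages are not closed under union. -/

import Mathlib

/-- A `Λ`-labeled graph: finite sets of nodes and edges, with source/target maps
and an edge labeling. -/
structure LGraph (Λ : Type) : Type 1 where
  V : Type
  E : Type
  finV : Finite V
  finE : Finite E
  src : E → V
  tgt : E → V
  lab : E → Λ

/-- A morphism of `Λ`-labeled graphs: maps on nodes and edges commuting with
source and target and preserving labels. -/
structure LGraph.Hom {Λ : Type} (G H : LGraph Λ) : Type where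
  fV : G.V → H.V
  fE : G.E → H.E
  src_comm : ∀ e, H.src (fE e) = fV (G.src e)
  tgt_comm : ∀ e, H.tgt (fE e) = fV (G.tgt e)
  lab_comm : ∀ e, H.lab (fE e) = G.lab e

/-- Composition of graph morphisms. -/
def LGraph.Hom.comp {Λ : Type} {G H K : LGraph Λ} (ψ : LGraph.Hom H K)
    (φ : LGraph.Hom G H) : LGraph.Hom G K where
  fV := ψ.fV ∘ φ.fV
  fE := ψ.fE ∘ φ.fE
  src_comm e := by simp [Function.comp_apply, ψ.src_comm, φ.src_comm]
  tgt_comm e := by simp [Function.comp_apply, ψ.tgt_comm, φ.tgt_comm]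
  lab_comm e := by simp [Function.comp_apply, ψ.lab_comm, φ.lab_comm]

/-- `G → H`: there exists some graph morphism from `G` to `H`. -/
def LGraph.Arrow {Λ : Type} (G H : LGraph Λ) : Prop := Nonempty (LGraph.Hom G H)

/-- The type graph language `L(T) = {G | G → T}`. -/
def TGLang {Λ : Type} (T : LGraph Λ) : Set (LGraph Λ) := {G | LGraph.Arrow G T}

/-- The restriction graph language `L_R(R) = {G | R ↛ G}`. -/
def RGLang {Λ : Type} (R : LGraph Λ) : Set (LGraph Λ) := {G | ¬ LGraph.Arrow R G}

/-- The two-element label set `Λ = {A, B}`. -/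
inductive Lab : Type
  | A
  | B
deriving DecidableEq

/-- The graph with a single node and a single `l`-labeled loop. -/
def loopGraph (l : Lab) : LGraph Lab where
  V := Unit
  E := Unit
  finV := inferInstance
  finE := inferInstance
  src _ := ()
  tgt _ := ()
  lab _ := l

/-- There is no type graph `T` whose language is `L(G_A) ∪ L(G_B)`:
type graph languages are not closed under union. -/
theorem typeGraphLang_not_closed_union :
    ¬ ∃ T : LGraph Lab, TGLang T = TGLang (loopGraph Lab.A) ∪ TGLang (loopGraph Lab.B) := by
  rintro ⟨T, hT⟩
  have idm : ∀ G : LGraph Lab, G ∈ TGLang G := fun G =>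
    ⟨⟨id, id, fun _ => rfl, fun _ => rfl, fun _ => rfl⟩⟩
  have hA : loopGraph Lab.A ∈ TGLang T := by
    rw [hT]; exact Or.inl (idm _)
  have hB : loopGraph Lab.B ∈ TGLang T := by
    rw [hT]; exact Or.inr (idm _)
  have hTT : T ∈ TGLang (loopGraph Lab.A) ∪ TGLang (loopGraph Lab.B) := by
    rw [← hT]; exact idm T
  obtain ⟨a⟩ := hA
  obtain ⟨b⟩ := hB
  rcases hTT with ⟨⟨f⟩⟩ | ⟨⟨f⟩⟩
  · have h : Lab.A = Lab.B := (LGraph.Hom.comp f b).lab_comm ()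
    cases h
  · have h : Lab.B = Lab.A := (LGraph.Hom.comp f a).lab_comm ()
    cases h
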